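/- There exists a constant c ≥ 1 such that for all integers 0 ≤ n ≤ m and every f : V_m → ℝ one has D_n(f|_{V_n}) ≤ c·𝓡_{m−n}·D_m(f). (Restriction estimate; part (1) of Proposition 3.4 of the paper in the planar case.) -/

import Mathlib

open Finset
open scoped Classical

namespace Carpet

/-- The contraction map `Ψ_{(a,b)}(x,y) = ((x+a)/L, (y+b)/L)`. -/
noncomputable def Psi (L : ℕ) (p : ℕ × ℕ) (x : ℝ × ℝ) : ℝ × ℝ :=
  ((x.1 + p.1) / L, (x.2 + p.2) / L)

/-- Words of length `n` over the alphabet `A`. -/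
abbrev Word (A : Finset (ℕ × ℕ)) (n : ℕ) := Fin n → {p : ℕ × ℕ // p ∈ A}

/-- `Ψ_w = Ψ_{w₁} ∘ ⋯ ∘ Ψ_{w_n}`. -/
noncomputable def PsiW (L : ℕ) {A : Finset (ℕ × ℕ)} {n : ℕ} (w : Word A n) : ℝ × ℝ → ℝ × ℝ :=
  (List.ofFn fun i => Psi L (w i).1).foldr (· ∘ ·) id

/-- The four corners of the unit square. -/
noncomputable def V0 : Finset (ℝ × ℝ) :=
  {((0 : ℝ), (0 : ℝ)), ((1 : ℝ), (0 : ℝ)), ((1 : ℝ), (1 : ℝ)), ((0 : ℝ), (1 : ℝ))}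

/-- The level-`n` vertex set `V_n = ⋃_{w ∈ W_n} Ψ_w(V₀)`. -/
noncomputable def VN (L : ℕ) (A : Finset (ℕ × ℕ)) (n : ℕ) : Finset (ℝ × ℝ) :=
  (Finset.univ : Finset (Word A n)).biUnion fun w => V0.image (PsiW L w)

/-- Euclidean distance in the plane. -/
noncomputable def eudist (x y : ℝ × ℝ) : ℝ :=
  Real.sqrt ((x.1 - y.1) ^ 2 + (x.2 - y.2) ^ 2)

/-- `n`-adjacency: `x = Ψ_w(p)`, `y = Ψ_w(q)` with `p, q ∈ V₀`, `|p - q| = 1`. -/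
def Adj (L : ℕ) (A : Finset (ℕ × ℕ)) (n : ℕ) (x y : ℝ × ℝ) : Prop :=
  ∃ w : Word A n, ∃ p ∈ V0, ∃ q ∈ V0,
    eudist p q = 1 ∧ x = PsiW L w p ∧ y = PsiW L w q

/-- The natural graph energy `D_n(f) = Σ_{x ∼ y} (f x - f y)²`
(summing over ordered pairs and halving). -/
noncomputable def Dform (L : ℕ) (A : Finset (ℕ × ℕ)) (n : ℕ) (f : ℝ × ℝ → ℝ) : ℝ :=
  (1 / 2) * ∑ x ∈ VN L A n, ∑ y ∈ VN L A n,
    (if Adj L A n x y then (f x - f y) ^ 2 else 0)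

/-- The effective resistance between `S` and `T` in the level-`n` graph. -/
noncomputable def EffRes (L : ℕ) (A : Finset (ℕ × ℕ)) (n : ℕ) (S T : Set (ℝ × ℝ)) : ℝ :=
  (sInf {e : ℝ | ∃ f : ℝ × ℝ → ℝ,
      (∀ x ∈ S, f x = 1) ∧ (∀ x ∈ T, f x = 0) ∧ e = Dform L A n f})⁻¹

/-- `𝓡_n`, the resistance between the corners `(0,0)` and `(1,0)`. -/
noncomputable def RR (L : ℕ) (A : Finset (ℕ × ℕ)) (n : ℕ) : ℝ :=
  EffRes L A n {((0 : ℝ), (0 : ℝ))} {((1 : ℝ), (0 : ℝ))}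

/-- `𝓡̄_n`, the resistance between the left and right sides of the unit square. -/
noncomputable def RRbar (L : ℕ) (A : Finset (ℕ × ℕ)) (n : ℕ) : ℝ :=
  EffRes L A n
    ((VN L A n : Set (ℝ × ℝ)) ∩ ({(0 : ℝ)} ×ˢ Set.Icc (0 : ℝ) 1))
    ((VN L A n : Set (ℝ × ℝ)) ∩ ({(1 : ℝ)} ×ˢ Set.Icc (0 : ℝ) 1))

/-- The standing assumptions on `(L, A)` defining a generalized Sierpiński carpet. -/
structure GoodCarpet (L : ℕ) (A : Finset (ℕ × ℕ)) : Prop where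
  three_le : 3 ≤ L
  mem_lt : ∀ p ∈ A, p.1 < L ∧ p.2 < L
  symm_swap : ∀ a b : ℕ, (a, b) ∈ A → (b, a) ∈ A
  symm_reflect : ∀ a b : ℕ, (a, b) ∈ A → (L - 1 - a, b) ∈ A
  connected : IsConnected
    (⋃ p ∈ A, Set.Icc (((p.1 : ℝ) / L, (p.2 : ℝ) / L) : ℝ × ℝ)
      ((((p.1 : ℝ) + 1) / L, ((p.2 : ℝ) + 1) / L) : ℝ × ℝ))
  flat_border : ∀ a b : ℕ, a < L → b < L →
    (a = 0 ∨ a = L - 1 ∨ b = 0 ∨ b = L - 1) → (a, b) ∈ A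
  proper : ∃ a b : ℕ, a < L ∧ b < L ∧ (a, b) ∉ A

/-- The generalized Sierpiński carpet `F`. -/
def carpetF (L : ℕ) (A : Finset (ℕ × ℕ)) : Set (ℝ × ℝ) :=
  ⋂ n : ℕ, ⋃ w : Word A n, PsiW L w '' Set.Icc (((0 : ℝ), (0 : ℝ)) : ℝ × ℝ) ((1 : ℝ), (1 : ℝ))


/-! ### Basic facts on words and the maps -/

lemma PsiW_zero (L : ℕ) {A : Finset (ℕ × ℕ)} (w : Word A 0) : PsiW L w = id := by
  simp [PsiW]

lemma PsiW_succ (L : ℕ) {A : Finset (ℕ × ℕ)} {n : ℕ} (w : Word A (n + 1)) (x : ℝ × ℝ) :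
    PsiW L w x = Psi L (w 0).1 (PsiW L (Fin.tail w) x) := by
  simp [PsiW, List.ofFn_succ, Fin.tail]

lemma PsiW_cons (L : ℕ) {A : Finset (ℕ × ℕ)} {n : ℕ} (a : {p : ℕ × ℕ // p ∈ A})
    (w : Word A n) (x : ℝ × ℝ) :
    PsiW L (Fin.cons a w : Word A (n + 1)) x = Psi L a.1 (PsiW L w x) := by
  rw [PsiW_succ]; simp

lemma foldr_comp_append (l₁ l₂ : List (ℝ × ℝ → ℝ × ℝ)) :
    (l₁ ++ l₂).foldr (· ∘ ·) id = (l₁.foldr (· ∘ ·) id) ∘ (l₂.foldr (· ∘ ·) id) := by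
  induction l₁ with
  | nil => simp
  | cons a l ih => simp only [List.cons_append, List.foldr_cons, ih]; rfl

lemma exists_append (L : ℕ) {A : Finset (ℕ × ℕ)} {n k : ℕ} (w : Word A n) (v : Word A k) :
    ∃ u : Word A (n + k), ∀ x, PsiW L u x = PsiW L w (PsiW L v x) := by
  refine ⟨Fin.append w v, fun x => ?_⟩
  have : (List.ofFn fun i => Psi L (Fin.append w v i).1)
      = (List.ofFn fun i => Psi L (w i).1) ++ (List.ofFn fun i => Psi L (v i).1) := by
    rw [← List.ofFn_fin_append]
    congr 1
    funext i
    refine Fin.addCases (fun i => ?_) (fun i => ?_) i <;> simp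
  simp only [PsiW, this, foldr_comp_append]
  rfl

/-- The integer position of the cell of a word. -/
def Nw (L : ℕ) {A : Finset (ℕ × ℕ)} : (n : ℕ) → Word A n → ℕ × ℕ
  | 0, _ => (0, 0)
  | n + 1, w => ((w 0).1.1 * L ^ n + (Nw L n (Fin.tail w)).1,
      (w 0).1.2 * L ^ n + (Nw L n (Fin.tail w)).2)

lemma PsiW_eq {L : ℕ} (hL : 0 < L) {A : Finset (ℕ × ℕ)} (n : ℕ) (w : Word A n) (x : ℝ × ℝ) :
    PsiW L w x = ((x.1 + (Nw L n w).1) / (L : ℝ) ^ n, (x.2 + (Nw L n w).2) / (L : ℝ) ^ n) := by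
  have hL' : (L : ℝ) ≠ 0 := by positivity
  induction n with
  | zero => simp [PsiW_zero, Nw]
  | succ n ih =>
    rw [PsiW_succ, ih]
    simp only [Psi, Nw]
    push_cast
    ext
    · simp only; field_simp; ring
    · simp only; field_simp; ring

lemma Nw_lt {L : ℕ} {A : Finset (ℕ × ℕ)} (h : GoodCarpet L A) (n : ℕ) (w : Word A n) :
    (Nw L n w).1 < L ^ n ∧ (Nw L n w).2 < L ^ n := by
  induction n with
  | zero => simp [Nw]
  | succ n ih =>
    obtain ⟨h1, h2⟩ := ih (Fin.tail w)
    obtain ⟨h3, h4⟩ := h.mem_lt _ (w 0).2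
    simp only [Nw, pow_succ]
    constructor
    · have : ((w 0).1.1 + 1) * L ^ n ≤ L * L ^ n := Nat.mul_le_mul_right _ h3
      nlinarith
    · have : ((w 0).1.2 + 1) * L ^ n ≤ L * L ^ n := Nat.mul_le_mul_right _ h4
      nlinarith

lemma divmod_inj {M a b c d : ℕ} (hc : c < M) (hd : d < M) (e : a * M + c = b * M + d) :
    a = b ∧ c = d := by
  have hM : 0 < M := by omega
  have h1 : (a * M + c) / M = a := by
    rw [add_comm, Nat.add_mul_div_right _ _ hM, Nat.div_eq_of_lt hc, zero_add]
  have h2 : (b * M + d) / M = b := by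
    rw [add_comm, Nat.add_mul_div_right _ _ hM, Nat.div_eq_of_lt hd, zero_add]
  have : a = b := by rw [← h1, e, h2]
  subst this
  exact ⟨rfl, by omega⟩

lemma Nw_inj {L : ℕ} {A : Finset (ℕ × ℕ)} (h : GoodCarpet L A) (n : ℕ) :
    Function.Injective (Nw L n : Word A n → ℕ × ℕ) := by
  induction n with
  | zero => intro a b _; exact Subsingleton.elim _ _
  | succ n ih =>
    intro a b hab
    simp only [Nw, Prod.mk.injEq] at hab
    obtain ⟨e1, e2⟩ := hab
    obtain ⟨a1, a2⟩ := Nw_lt h n (Fin.tail a)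
    obtain ⟨b1, b2⟩ := Nw_lt h n (Fin.tail b)
    obtain ⟨p1, p2⟩ := divmod_inj a1 b1 e1
    obtain ⟨q1, q2⟩ := divmod_inj a2 b2 e2
    have ht : Fin.tail a = Fin.tail b := ih (Prod.ext p2 q2)
    have h0 : a 0 = b 0 := Subtype.ext (Prod.ext p1 q1)
    rw [← Fin.cons_self_tail a, ← Fin.cons_self_tail b, ht, h0]

lemma PsiW_inj {L : ℕ} (hL : 0 < L) {A : Finset (ℕ × ℕ)} {n : ℕ} (w : Word A n) :
    Function.Injective (PsiW L w) := by
  have hL' : (L : ℝ) ^ n ≠ 0 := by positivity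
  intro x y hxy
  rw [PsiW_eq hL, PsiW_eq hL] at hxy
  simp only [Prod.mk.injEq, div_left_inj' hL', add_left_inj] at hxy
  exact Prod.ext hxy.1 hxy.2

lemma mem_VN {L : ℕ} {A : Finset (ℕ × ℕ)} {n : ℕ} {x : ℝ × ℝ} :
    x ∈ VN L A n ↔ ∃ w : Word A n, ∃ p ∈ V0, PsiW L w p = x := by
  simp [VN]

lemma V0_unit {p : ℝ × ℝ} (hp : p ∈ V0) : (0 ≤ p.1 ∧ p.1 ≤ 1) ∧ (0 ≤ p.2 ∧ p.2 ≤ 1) := by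
  simp only [V0, Finset.mem_insert, Finset.mem_singleton] at hp
  rcases hp with rfl | rfl | rfl | rfl <;> norm_num

lemma VN_unit {L : ℕ} {A : Finset (ℕ × ℕ)} (h : GoodCarpet L A) {n : ℕ} {x : ℝ × ℝ}
    (hx : x ∈ VN L A n) : (0 ≤ x.1 ∧ x.1 ≤ 1) ∧ (0 ≤ x.2 ∧ x.2 ≤ 1) := by
  obtain ⟨w, p, hp, rfl⟩ := mem_VN.1 hx
  have hL : 0 < L := by have := h.three_le; omega
  have hL' : (0 : ℝ) < (L : ℝ) ^ n := by positivity
  obtain ⟨⟨a, b⟩, c, d⟩ := V0_unit hp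
  obtain ⟨e, g⟩ := Nw_lt h n w
  have e' : ((Nw L n w).1 : ℝ) + 1 ≤ (L : ℝ) ^ n := by exact_mod_cast e
  have g' : ((Nw L n w).2 : ℝ) + 1 ≤ (L : ℝ) ^ n := by exact_mod_cast g
  rw [PsiW_eq hL]
  refine ⟨⟨by positivity, ?_⟩, by positivity, ?_⟩
  · simp only; rw [div_le_one hL']; linarith
  · simp only; rw [div_le_one hL']; linarith

lemma Adj_mem {L : ℕ} {A : Finset (ℕ × ℕ)} {n : ℕ} {x y : ℝ × ℝ} (hxy : Adj L A n x y) :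
    x ∈ VN L A n ∧ y ∈ VN L A n := by
  obtain ⟨w, p, hp, q, hq, -, rfl, rfl⟩ := hxy
  exact ⟨mem_VN.2 ⟨w, p, hp, rfl⟩, mem_VN.2 ⟨w, q, hq, rfl⟩⟩

lemma Adj_map {L : ℕ} {A : Finset (ℕ × ℕ)} {n k : ℕ} {x y : ℝ × ℝ} (w : Word A n)
    (hxy : Adj L A k x y) : Adj L A (n + k) (PsiW L w x) (PsiW L w y) := by
  obtain ⟨v, p, hp, q, hq, e, rfl, rfl⟩ := hxy
  obtain ⟨u, hu⟩ := exists_append L w v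
  exact ⟨u, p, hp, q, hq, e, (hu p).symm, (hu q).symm⟩

lemma VN_map {L : ℕ} {A : Finset (ℕ × ℕ)} {n k : ℕ} {x : ℝ × ℝ} (w : Word A n)
    (hx : x ∈ VN L A k) : PsiW L w x ∈ VN L A (n + k) := by
  obtain ⟨v, p, hp, rfl⟩ := mem_VN.1 hx
  obtain ⟨u, hu⟩ := exists_append L w v
  exact mem_VN.2 ⟨u, p, hp, hu p⟩

lemma Dform_nonneg (L : ℕ) (A : Finset (ℕ × ℕ)) (n : ℕ) (f : ℝ × ℝ → ℝ) :
    0 ≤ Dform L A n f := by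
  unfold Dform
  refine mul_nonneg (by norm_num) (Finset.sum_nonneg fun x _ => Finset.sum_nonneg fun y _ => ?_)
  split_ifs <;> positivity

lemma edge_le_Dform {L : ℕ} {A : Finset (ℕ × ℕ)} {n : ℕ} (f : ℝ × ℝ → ℝ) {x y : ℝ × ℝ}
    (hxy : Adj L A n x y) : (f x - f y) ^ 2 ≤ 2 * Dform L A n f := by
  obtain ⟨hx, hy⟩ := Adj_mem hxy
  have nn : ∀ x y, 0 ≤ (if Adj L A n x y then (f x - f y) ^ 2 else 0) := by
    intro x y; split_ifs <;> positivity
  have h1 : (f x - f y) ^ 2 ≤ ∑ y ∈ VN L A n, (if Adj L A n x y then (f x - f y) ^ 2 else 0) := by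
    have := Finset.single_le_sum (f := fun y => if Adj L A n x y then (f x - f y) ^ 2 else 0)
      (fun y _ => nn x y) hy
    simpa [hxy] using this
  have h2 := Finset.single_le_sum
    (f := fun x => ∑ y ∈ VN L A n, (if Adj L A n x y then (f x - f y) ^ 2 else 0))
      (fun x _ => Finset.sum_nonneg fun y _ => nn x y) hx
  unfold Dform
  linarith

/-! ### Positivity of the conductance -/

lemma bottom_adj {L : ℕ} {A : Finset (ℕ × ℕ)} (h : GoodCarpet L A) (k i : ℕ) (hi : i < L ^ k) :
    Adj L A k ((i : ℝ) / (L : ℝ) ^ k, 0) (((i + 1 : ℕ) : ℝ) / (L : ℝ) ^ k, 0) := by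
  have hL : 0 < L := by have := h.three_le; omega
  have hL' : (L : ℝ) ≠ 0 := by positivity
  induction k generalizing i with
  | zero =>
    have : i = 0 := by simpa using hi
    subst this
    refine ⟨Fin.elim0, (0, 0), by simp [V0], (1, 0), by simp [V0], by simp [eudist], ?_, ?_⟩ <;>
      simp [PsiW_zero]
  | succ k ih =>
    have hpos : 0 < L ^ k := by positivity
    have ha : i / L ^ k < L := by
      rw [Nat.div_lt_iff_lt_mul hpos, mul_comm, ← pow_succ]; exact hi
    obtain ⟨v, p, hp, q, hq, e, e1, e2⟩ := ih (i % L ^ k) (Nat.mod_lt _ hpos)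
    have hA : (i / L ^ k, 0) ∈ A := h.flat_border _ _ ha hL (by simp)
    have hi' : (i : ℝ) = (L : ℝ) ^ k * ((i / L ^ k : ℕ) : ℝ) + ((i % L ^ k : ℕ) : ℝ) := by
      exact_mod_cast (Nat.div_add_mod i (L ^ k)).symm
    refine ⟨Fin.cons ⟨_, hA⟩ v, p, hp, q, hq, e, ?_, ?_⟩
    · rw [PsiW_cons, ← e1]
      simp only [Psi]
      ext
      · simp only; rw [hi']; field_simp; ring
      · simp
    · rw [PsiW_cons, ← e2]
      simp only [Psi]
      ext
      · simp only; push_cast; rw [hi']; field_simp; ring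
      · simp

lemma corner_bound {L : ℕ} {A : Finset (ℕ × ℕ)} (h : GoodCarpet L A) (k : ℕ) (f : ℝ × ℝ → ℝ) :
    |f (0, 0) - f (1, 0)| ≤ (L : ℝ) ^ k * Real.sqrt (2 * Dform L A k f) := by
  have hL : 0 < L := by have := h.three_le; omega
  have hL' : (L : ℝ) ^ k ≠ 0 := by positivity
  have key : ∀ i : ℕ, i ≤ L ^ k →
      |f (0, 0) - f ((i : ℝ) / (L : ℝ) ^ k, 0)| ≤ i * Real.sqrt (2 * Dform L A k f) := by
    intro i
    induction i with
    | zero => intro _; simp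
    | succ i ih =>
      intro hi
      have h1 := ih (by omega)
      have h2 := Real.abs_le_sqrt (edge_le_Dform f (bottom_adj h k i hi))
      have h3 := abs_sub_le (f (0, 0)) (f ((i : ℝ) / (L : ℝ) ^ k, 0))
        (f (((i + 1 : ℕ) : ℝ) / (L : ℝ) ^ k, 0))
      push_cast at h2 h3 ⊢
      linarith
  have := key (L ^ k) le_rfl
  push_cast at this
  rwa [div_self hL'] at this

/-- The conductance between the corners. -/
noncomputable def ss (L : ℕ) (A : Finset (ℕ × ℕ)) (k : ℕ) : ℝ :=
  sInf {e : ℝ | ∃ f : ℝ × ℝ → ℝ,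
      (∀ x ∈ ({((0 : ℝ), (0 : ℝ))} : Set (ℝ × ℝ)), f x = 1) ∧
      (∀ x ∈ ({((1 : ℝ), (0 : ℝ))} : Set (ℝ × ℝ)), f x = 0) ∧ e = Dform L A k f}

lemma RR_eq (L : ℕ) (A : Finset (ℕ × ℕ)) (k : ℕ) : RR L A k = (ss L A k)⁻¹ := rfl

lemma ss_pos {L : ℕ} {A : Finset (ℕ × ℕ)} (h : GoodCarpet L A) (k : ℕ) : 0 < ss L A k := by
  have hL : 0 < L := by have := h.three_le; omega
  have hL' : (0 : ℝ) < (L : ℝ) ^ k := by positivity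
  have : 1 / (2 * ((L : ℝ) ^ k) ^ 2) ≤ ss L A k := by
    apply le_csInf
    · exact ⟨_, fun x => if x = (0, 0) then 1 else 0, by simp, by simp, rfl⟩
    · rintro e ⟨f, h0, h1, rfl⟩
      have := corner_bound h k f
      rw [h0 _ rfl, h1 _ rfl] at this
      simp only [sub_zero, abs_one] at this
      have hs := Real.sq_sqrt (mul_nonneg zero_le_two (Dform_nonneg L A k f))
      have h2 : (1 : ℝ) ≤ ((L : ℝ) ^ k * Real.sqrt (2 * Dform L A k f)) ^ 2 :=
        one_le_pow₀ this
      rw [mul_pow, hs] at h2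
      rw [div_le_iff₀ (by positivity)]
      linarith
  exact lt_of_lt_of_le (by positivity) this

lemma Dform_affine (L : ℕ) (A : Finset (ℕ × ℕ)) (k : ℕ) (f : ℝ × ℝ → ℝ) (a b : ℝ) :
    Dform L A k (fun x => (f x - a) / b) = Dform L A k f / b ^ 2 := by
  unfold Dform
  rw [mul_div_assoc, Finset.sum_div]
  congr 1
  refine Finset.sum_congr rfl fun x _ => ?_
  rw [Finset.sum_div]
  refine Finset.sum_congr rfl fun y _ => ?_
  split_ifs
  · rw [← div_pow]; congr 1; ring
  · simp

lemma ss_le (L : ℕ) (A : Finset (ℕ × ℕ)) (k : ℕ) (f : ℝ × ℝ → ℝ) :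
    ss L A k * (f (0, 0) - f (1, 0)) ^ 2 ≤ Dform L A k f := by
  by_cases hf : f (0, 0) - f (1, 0) = 0
  · rw [hf]; simpa using Dform_nonneg L A k f
  · have hp : 0 < (f (0, 0) - f (1, 0)) ^ 2 := by positivity
    rw [← le_div_iff₀ hp, ← Dform_affine L A k f (f (1, 0))]
    apply csInf_le
    · exact ⟨0, by rintro e ⟨g, -, -, rfl⟩; exact Dform_nonneg L A k g⟩
    · refine ⟨_, ?_, ?_, rfl⟩
      · rintro x rfl; exact div_self hf
      · rintro x rfl; simp

/-! ### Symmetries -/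

lemma Dform_symm {L : ℕ} {A : Finset (ℕ × ℕ)} {k : ℕ} (σ : ℝ × ℝ → ℝ × ℝ)
    (hσ : ∀ x, σ (σ x) = x) (hV : ∀ x ∈ VN L A k, σ x ∈ VN L A k)
    (hA : ∀ x y, Adj L A k x y → Adj L A k (σ x) (σ y)) (f : ℝ × ℝ → ℝ) :
    Dform L A k (fun x => f (σ x)) = Dform L A k f := by
  have hA' : ∀ x y, Adj L A k x y ↔ Adj L A k (σ x) (σ y) := fun x y =>
    ⟨hA x y, fun hh => by simpa [hσ] using hA _ _ hh⟩
  unfold Dform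
  congr 1
  refine Finset.sum_nbij' σ σ hV hV (fun x _ => hσ x) (fun x _ => hσ x) fun x _ => ?_
  refine Finset.sum_nbij' σ σ hV hV (fun x _ => hσ x) (fun x _ => hσ x) fun y _ => ?_
  simp only [← hA' x y]

lemma symm_of_words {L : ℕ} {A : Finset (ℕ × ℕ)} {k : ℕ} (σ : ℝ × ℝ → ℝ × ℝ)
    (hσ : ∀ x, σ (σ x) = x) (h0 : ∀ p ∈ V0, σ p ∈ V0)
    (hd : ∀ p q, eudist (σ p) (σ q) = eudist p q)
    (hw : ∀ a ∈ A, ∃ b ∈ A, ∀ x, σ (Psi L a x) = Psi L b (σ x)) (f : ℝ × ℝ → ℝ) :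
    Dform L A k (fun x => f (σ x)) = Dform L A k f := by
  have hW : ∀ (k : ℕ) (w : Word A k), ∃ v : Word A k, ∀ x, σ (PsiW L w x) = PsiW L v (σ x) := by
    intro k
    induction k with
    | zero => intro w; exact ⟨w, fun x => by simp [PsiW_zero]⟩
    | succ k ih =>
      intro w
      obtain ⟨v, hv⟩ := ih (Fin.tail w)
      obtain ⟨b, hb, hb'⟩ := hw _ (w 0).2
      exact ⟨Fin.cons ⟨b, hb⟩ v, fun x => by rw [PsiW_cons, PsiW_succ, hb', hv]⟩
  apply Dform_symm σ hσ
  · intro x hx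
    obtain ⟨w, p, hp, rfl⟩ := mem_VN.1 hx
    obtain ⟨v, hv⟩ := hW k w
    exact mem_VN.2 ⟨v, σ p, h0 p hp, (hv p).symm⟩
  · rintro x y ⟨w, p, hp, q, hq, e, rfl, rfl⟩
    obtain ⟨v, hv⟩ := hW k w
    exact ⟨v, σ p, h0 p hp, σ q, h0 q hq, by rw [hd, e], hv p, hv q⟩

lemma Dform_swap {L : ℕ} {A : Finset (ℕ × ℕ)} (h : GoodCarpet L A) (k : ℕ) (f : ℝ × ℝ → ℝ) :
    Dform L A k (fun x => f (x.2, x.1)) = Dform L A k f := by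
  apply symm_of_words (fun x => (x.2, x.1))
  · intro x; rfl
  · intro p hp
    simp only [V0, Finset.mem_insert, Finset.mem_singleton] at hp
    rcases hp with rfl | rfl | rfl | rfl <;> simp [V0]
  · intro p q; simp [eudist, add_comm]
  · rintro ⟨a, b⟩ hab
    exact ⟨(b, a), h.symm_swap a b hab, fun x => rfl⟩

lemma Dform_reflect {L : ℕ} {A : Finset (ℕ × ℕ)} (h : GoodCarpet L A) (k : ℕ)
    (f : ℝ × ℝ → ℝ) :
    Dform L A k (fun x => f (1 - x.1, x.2)) = Dform L A k f := by
  apply symm_of_words (fun x => (1 - x.1, x.2))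
  · intro x; simp
  · intro p hp
    simp only [V0, Finset.mem_insert, Finset.mem_singleton] at hp
    rcases hp with rfl | rfl | rfl | rfl <;> simp [V0]
  · intro p q; simp only [eudist]; congr 1; ring
  · rintro ⟨a, b⟩ hab
    refine ⟨(L - 1 - a, b), h.symm_reflect a b hab, fun x => ?_⟩
    have h1 : a < L := (h.mem_lt _ hab).1
    have hL' : (L : ℝ) ≠ 0 := by have : 0 < L := by omega
                                 positivity
    have h2 : ((L - 1 - a : ℕ) : ℝ) = (L : ℝ) - 1 - a := by
      rw [Nat.cast_sub (by omega), Nat.cast_sub (by omega)]; simp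
    simp only [Psi, h2]
    ext
    · simp only; field_simp; ring
    · rfl

lemma edge_bound {L : ℕ} {A : Finset (ℕ × ℕ)} (h : GoodCarpet L A) (k : ℕ) (f : ℝ × ℝ → ℝ)
    {p q : ℝ × ℝ} (hp : p ∈ V0) (hq : q ∈ V0) (hpq : eudist p q = 1) :
    ss L A k * (f p - f q) ^ 2 ≤ Dform L A k f := by
  have e1 : ∀ f : ℝ × ℝ → ℝ, ss L A k * (f (0, 0) - f (1, 0)) ^ 2 ≤ Dform L A k f := ss_le L A k
  have e2 : ∀ f : ℝ × ℝ → ℝ, ss L A k * (f (0, 0) - f (0, 1)) ^ 2 ≤ Dform L A k f := by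
    intro f
    have := e1 (fun x => f (x.2, x.1))
    rwa [Dform_swap h] at this
  have e3 : ∀ f : ℝ × ℝ → ℝ, ss L A k * (f (1, 0) - f (1, 1)) ^ 2 ≤ Dform L A k f := by
    intro f
    have := e2 (fun x => f (1 - x.1, x.2))
    rw [Dform_reflect h] at this
    simpa using this
  have e4 : ∀ f : ℝ × ℝ → ℝ, ss L A k * (f (0, 1) - f (1, 1)) ^ 2 ≤ Dform L A k f := by
    intro f
    have := e3 (fun x => f (x.2, x.1))
    rwa [Dform_swap h] at this
  have hpq2 : (p.1 - q.1) ^ 2 + (p.2 - q.2) ^ 2 = 1 := by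
    have := hpq
    rw [eudist, Real.sqrt_eq_one] at this
    exact this
  have f1 := e1 f
  have f2 := e2 f
  have f3 := e3 f
  have f4 := e4 f
  simp only [V0, Finset.mem_insert, Finset.mem_singleton] at hp hq
  rcases hp with rfl | rfl | rfl | rfl <;> rcases hq with rfl | rfl | rfl | rfl <;>
    first
      | (exfalso; norm_num at hpq2; done)
      | assumption
      | (rw [sub_sq_comm]; assumption)

/-! ### Summation over cells -/

lemma Dform_le_cells (L : ℕ) (A : Finset (ℕ × ℕ)) (n : ℕ) (f : ℝ × ℝ → ℝ) (C : Word A n → ℝ)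
    (hC : ∀ w : Word A n, ∀ p ∈ V0, ∀ q ∈ V0, eudist p q = 1 →
      (f (PsiW L w p) - f (PsiW L w q)) ^ 2 ≤ C w) (hC0 : ∀ w, 0 ≤ C w) :
    Dform L A n f ≤ 8 * ∑ w, C w := by
  set T : Finset (Word A n × (ℝ × ℝ) × (ℝ × ℝ)) := Finset.univ ×ˢ (V0 ×ˢ V0) with hT
  have h1 : ∀ x y, (if Adj L A n x y then (f x - f y) ^ 2 else 0)
      ≤ ∑ t ∈ T, if x = PsiW L t.1 t.2.1 ∧ y = PsiW L t.1 t.2.2 then C t.1 else 0 := by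
    intro x y
    have nn : ∀ t ∈ T, 0 ≤ (if x = PsiW L t.1 t.2.1 ∧ y = PsiW L t.1 t.2.2 then C t.1 else 0) := by
      intro t _; split_ifs; exacts [hC0 _, le_rfl]
    split_ifs with hxy
    · obtain ⟨w, p, hp, q, hq, e, hx, hy⟩ := hxy
      have hm : (w, p, q) ∈ T := by simp [hT, hp, hq]
      refine le_trans ?_ (Finset.single_le_sum nn hm)
      simp only [hx, hy, and_self, if_true]
      exact hC w p hp q hq e
    · exact Finset.sum_nonneg nn
  have h2 : ∀ t : Word A n × (ℝ × ℝ) × (ℝ × ℝ),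
      ∑ x ∈ VN L A n, ∑ y ∈ VN L A n,
        (if x = PsiW L t.1 t.2.1 ∧ y = PsiW L t.1 t.2.2 then C t.1 else 0) ≤ C t.1 := by
    intro t
    have : ∀ x, ∑ y ∈ VN L A n,
        (if x = PsiW L t.1 t.2.1 ∧ y = PsiW L t.1 t.2.2 then C t.1 else 0)
        ≤ if x = PsiW L t.1 t.2.1 then C t.1 else 0 := by
      intro x
      by_cases hx : x = PsiW L t.1 t.2.1
      · simp only [hx, true_and, if_true, Finset.sum_ite_eq']
        split_ifs; exacts [le_rfl, hC0 _]
      · simp [hx]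
    refine (Finset.sum_le_sum fun x _ => this x).trans ?_
    rw [Finset.sum_ite_eq']
    split_ifs; exacts [le_rfl, hC0 _]
  have h3 : ∑ x ∈ VN L A n, ∑ y ∈ VN L A n, (if Adj L A n x y then (f x - f y) ^ 2 else 0)
      ≤ ∑ t ∈ T, C t.1 := by
    calc _ ≤ ∑ x ∈ VN L A n, ∑ y ∈ VN L A n, ∑ t ∈ T,
          (if x = PsiW L t.1 t.2.1 ∧ y = PsiW L t.1 t.2.2 then C t.1 else 0) :=
          Finset.sum_le_sum fun x _ => Finset.sum_le_sum fun y _ => h1 x y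
      _ = ∑ t ∈ T, ∑ x ∈ VN L A n, ∑ y ∈ VN L A n,
          (if x = PsiW L t.1 t.2.1 ∧ y = PsiW L t.1 t.2.2 then C t.1 else 0) := by
          rw [Finset.sum_comm]
          rw [Finset.sum_congr rfl fun y _ => Finset.sum_comm]
          rw [Finset.sum_comm]
          exact Finset.sum_congr rfl fun t _ => Finset.sum_comm
      _ ≤ _ := Finset.sum_le_sum fun t _ => h2 t
  have h4 : ∑ t ∈ T, C t.1 = 16 * ∑ w, C w := by
    rw [hT, Finset.sum_product]
    have hc : (V0 ×ˢ V0).card = 16 := by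
      rw [Finset.card_product]
      have : V0.card = 4 := by
        unfold V0
        rw [Finset.card_insert_of_notMem, Finset.card_insert_of_notMem,
          Finset.card_insert_of_notMem, Finset.card_singleton] <;> simp
      rw [this]
    simp only [Finset.sum_const, hc, nsmul_eq_mul, Finset.mul_sum]
    norm_num
  unfold Dform
  linarith

lemma card_cells {L : ℕ} {A : Finset (ℕ × ℕ)} (h : GoodCarpet L A) (n k : ℕ) (X : ℝ × ℝ) :
    ((Finset.univ : Finset (Word A n)).filter
      fun w => X ∈ (VN L A k).image (PsiW L w)).card ≤ 4 := by
  have hL : 0 < L := by have := h.three_le; omega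
  have hL' : (L : ℝ) ^ n ≠ 0 := by positivity
  set a : ℤ := ⌊(L : ℝ) ^ n * X.1⌋ with ha
  set b : ℤ := ⌊(L : ℝ) ^ n * X.2⌋ with hb
  have hcard : ((Finset.Icc (a - 1) a) ×ˢ (Finset.Icc (b - 1) b)).card = 4 := by
    simp
  rw [← hcard]
  apply Finset.card_le_card_of_injOn
    (fun w => (((Nw L n w).1 : ℤ), ((Nw L n w).2 : ℤ)))
  · intro w hw
    simp only [Finset.coe_filter, Finset.mem_univ, true_and, Set.mem_setOf_eq,
      Finset.mem_image] at hw
    obtain ⟨x, hx, rfl⟩ := hw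
    obtain ⟨⟨u1, u2⟩, u3, u4⟩ := VN_unit h hx
    rw [PsiW_eq hL] at ha hb
    simp only [mul_div_cancel₀ _ hL', Int.floor_add_natCast] at ha hb
    have a0 : 0 ≤ ⌊x.1⌋ := Int.floor_nonneg.2 u1
    have a1 : ⌊x.1⌋ ≤ 1 := by
      have := Int.floor_le_floor u2; simpa using this
    have b0 : 0 ≤ ⌊x.2⌋ := Int.floor_nonneg.2 u3
    have b1 : ⌊x.2⌋ ≤ 1 := by
      have := Int.floor_le_floor u4; simpa using this
    simp only [Finset.coe_product, Finset.coe_Icc, Set.mem_prod, Set.mem_Icc]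
    omega
  · intro w _ v _ hwv
    simp only [Prod.mk.injEq, Nat.cast_inj] at hwv
    exact Nw_inj h n (Prod.ext hwv.1 hwv.2)

lemma cells_le_Dform {L : ℕ} {A : Finset (ℕ × ℕ)} (h : GoodCarpet L A) (n k : ℕ)
    (f : ℝ × ℝ → ℝ) :
    ∑ w : Word A n, Dform L A k (fun x => f (PsiW L w x)) ≤ 4 * Dform L A (n + k) f := by
  have hL : 0 < L := by have := h.three_le; omega
  set E : ℝ × ℝ → ℝ × ℝ → ℝ := fun X Y => if Adj L A (n + k) X Y then (f X - f Y) ^ 2 else 0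
    with hE
  have E0 : ∀ X Y, 0 ≤ E X Y := by intro X Y; simp only [hE]; split_ifs <;> positivity
  set G : ℝ × ℝ → ℝ := fun X => ∑ Y ∈ VN L A (n + k), E X Y with hG
  have G0 : ∀ X, 0 ≤ G X := fun X => Finset.sum_nonneg fun Y _ => E0 X Y
  have hsub : ∀ w : Word A n, (VN L A k).image (PsiW L w) ⊆ VN L A (n + k) := by
    intro w X hX
    obtain ⟨x, hx, rfl⟩ := Finset.mem_image.1 hX
    exact VN_map w hx
  have h1 : ∀ w : Word A n, ∑ x ∈ VN L A k, ∑ y ∈ VN L A k,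
      (if Adj L A k x y then (f (PsiW L w x) - f (PsiW L w y)) ^ 2 else 0)
      ≤ ∑ X ∈ VN L A (n + k), if X ∈ (VN L A k).image (PsiW L w) then G X else 0 := by
    intro w
    have inj : Set.InjOn (PsiW L w) (VN L A k) := (PsiW_inj hL w).injOn
    calc _ ≤ ∑ x ∈ VN L A k, ∑ y ∈ VN L A k, E (PsiW L w x) (PsiW L w y) := by
          refine Finset.sum_le_sum fun x _ => Finset.sum_le_sum fun y _ => ?_
          split_ifs with hxy
          · simp only [hE, if_pos (Adj_map w hxy)]; exact le_rfl
          · exact E0 _ _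
      _ ≤ ∑ x ∈ VN L A k, G (PsiW L w x) := by
          refine Finset.sum_le_sum fun x _ => ?_
          rw [← Finset.sum_image (f := fun Y => E (PsiW L w x) Y) inj]
          exact Finset.sum_le_sum_of_subset_of_nonneg (hsub w) fun Y _ _ => E0 _ _
      _ = ∑ X ∈ (VN L A k).image (PsiW L w), G X := (Finset.sum_image inj).symm
      _ = _ := by
          rw [← Finset.sum_filter]
          congr 1
          ext X
          simp only [Finset.mem_filter]
          exact ⟨fun hX => ⟨hsub w hX, hX⟩, fun hX => hX.2⟩
  have h2 : ∑ w : Word A n, ∑ x ∈ VN L A k, ∑ y ∈ VN L A k,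
      (if Adj L A k x y then (f (PsiW L w x) - f (PsiW L w y)) ^ 2 else 0)
      ≤ 4 * ∑ X ∈ VN L A (n + k), G X := by
    refine (Finset.sum_le_sum fun w _ => h1 w).trans ?_
    rw [Finset.sum_comm, Finset.mul_sum]
    refine Finset.sum_le_sum fun X _ => ?_
    rw [← Finset.sum_filter, Finset.sum_const, nsmul_eq_mul]
    exact mul_le_mul_of_nonneg_right (by exact_mod_cast card_cells h n k X) (G0 X)
  unfold Dform
  rw [← Finset.mul_sum]
  simp only [hG, hE] at h2
  linarith

/-- Proposition 3.4 (1), planar case: restriction estimate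
`D_n(f|_{V_n}) ≤ c · 𝓡_{m-n} · D_m(f)`. -/
theorem restriction_estimate (L : ℕ) (A : Finset (ℕ × ℕ)) (h : GoodCarpet L A) :
    ∃ c : ℝ, 1 ≤ c ∧ ∀ n m : ℕ, n ≤ m → ∀ f : ℝ × ℝ → ℝ,
      Dform L A n f ≤ c * (RR L A (m - n) * Dform L A m f) := by
  refine ⟨32, by norm_num, fun n m hnm f => ?_⟩
  obtain ⟨k, rfl⟩ := Nat.exists_eq_add_of_le hnm
  rw [Nat.add_sub_cancel_left, RR_eq]
  have hs := ss_pos h k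
  have h1 := Dform_le_cells L A n f
    (fun w => (ss L A k)⁻¹ * Dform L A k (fun x => f (PsiW L w x)))
    (fun w p hp q hq e => by
      rw [inv_mul_eq_div, le_div_iff₀ hs, mul_comm]
      exact edge_bound h k (fun x => f (PsiW L w x)) hp hq e)
    (fun w => mul_nonneg (inv_nonneg.2 hs.le) (Dform_nonneg _ _ _ _))
  rw [← Finset.mul_sum] at h1
  have h2 := mul_le_mul_of_nonneg_left (cells_le_Dform h n k f) (inv_nonneg.2 hs.le)
  linarith


end Carpet
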